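/- Let N ≥ 3, let a ∈ C²(ℝ) with a(s) ≥ ν > 0 for all s ∈ ℝ, let k > 0, a₁ > 0 with lim_{s→+∞} a(s)/s^k = a₁, let 1 < p < ((k+1)N+2)/(N−2) and m > 0, and let g be the solution of g'(s) = 1/√(a(g(s))), g(0) = 0. Define h(t) = (|g(t)|^{p−1} g(t) − m g(t))/√(a(g(t))). Then lim_{t→0} |h(t)|/|t| = m/a(0) and lim_{t→+∞} |h(t)|/t^{(N+2)/(N−2)} = 0. -/

import Mathlib

open Filter Real Topology

/-- A function bounded below by a positive constant and asymptotic to `a₁ * s ^ k` at infinity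
dominates a positive multiple of `(1 + s) ^ k` on the nonnegative half-line. -/
theorem exists_pos_mul_one_add_rpow_le {a : ℝ → ℝ} {ν k a₁ : ℝ} (hν : 0 < ν)
    (hbound : ∀ s, ν ≤ a s) (hk : 0 < k) (ha₁ : 0 < a₁)
    (hlim : Tendsto (fun s : ℝ => a s / s ^ k) atTop (𝓝 a₁)) :
    ∃ c, 0 < c ∧ ∀ s, 0 ≤ s → c * (1 + s) ^ k ≤ a s := by
  obtain ⟨S, hS⟩ := eventually_atTop.1
    ((hlim.eventually (lt_mem_nhds (half_lt_self ha₁))).and (eventually_ge_atTop 1))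
  have hS1 : 1 ≤ S := (hS S le_rfl).2
  have hSk : 0 < (1 + S) ^ k := by positivity
  refine ⟨min (a₁ / 2 / 2 ^ k) (ν / (1 + S) ^ k), by positivity, fun s hs => ?_⟩
  rcases le_total S s with h | h
  · have hs1 : 1 ≤ s := hS1.trans h
    have hsk : 0 < s ^ k := by positivity
    have h1 : a₁ / 2 * s ^ k ≤ a s := ((lt_div_iff₀ hsk).1 (hS s h).1).le
    have h2 : (1 + s) ^ k ≤ 2 ^ k * s ^ k := by
      rw [← mul_rpow (by norm_num) hs]
      gcongr
      linarith
    calc _ ≤ a₁ / 2 / 2 ^ k * (2 ^ k * s ^ k) := by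
          gcongr
          exact min_le_left _ _
      _ = a₁ / 2 * s ^ k := by field_simp
      _ ≤ a s := h1
  · calc _ ≤ ν / (1 + S) ^ k * (1 + S) ^ k := by
          gcongr
          exact min_le_right _ _
      _ = ν := by field_simp
      _ ≤ a s := hbound s

theorem sqrt_mul_rpow_half_le_sqrt {c y k b : ℝ} (hc : 0 ≤ c) (hy : 0 ≤ y)
    (h : c * y ^ k ≤ b) : √c * y ^ (k / 2) ≤ √b := by
  apply Real.le_sqrt_of_sq_le
  rw [mul_pow, Real.sq_sqrt hc, ← rpow_natCast, ← rpow_mul hy]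
  convert h using 3
  push_cast
  ring

/-- If `g' = 1 / √(a ∘ g)`, `g 0 = 0` and `a s` dominates `c * (1 + s) ^ k`, then
`(1 + g) ^ (k / 2 + 1)` grows at most linearly. -/
theorem one_add_rpow_le_of_hasDerivAt_one_div_sqrt {a g : ℝ → ℝ} {c k : ℝ} (hc : 0 < c)
    (hk : 0 < k) (hac : ∀ s, 0 ≤ s → c * (1 + s) ^ k ≤ a s)
    (hg : ∀ s, HasDerivAt g (1 / √(a (g s))) s) (hpos : ∀ t, 0 ≤ t → 0 ≤ g t) (hg0 : g 0 = 0)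
    {t : ℝ} (ht : 0 ≤ t) :
    (1 + g t) ^ (k / 2 + 1) ≤ 1 + (k / 2 + 1) / √c * t := by
  have hd : ∀ x, 0 ≤ x → HasDerivAt (fun x => (1 + g x) ^ (k / 2 + 1))
      (1 / √(a (g x)) * (k / 2 + 1) * (1 + g x) ^ (k / 2 + 1 - 1)) x := fun x hx =>
    ((hg x).const_add 1).rpow_const (Or.inl (by linarith [hpos x hx]))
  have key := (convex_Ici (0 : ℝ)).image_sub_le_mul_sub_of_deriv_le
    (f := fun x => (1 + g x) ^ (k / 2 + 1))
    (fun x hx => (hd x hx).continuousAt.continuousWithinAt)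
    (fun x hx => (hd x (interior_subset hx)).differentiableAt.differentiableWithinAt)
    (C := (k / 2 + 1) / √c) (fun x hx => by
      have hx0 : (0 : ℝ) ≤ x := interior_subset hx
      have hy := hpos x hx0
      have hsq : √c * (1 + g x) ^ (k / 2) ≤ √(a (g x)) :=
        sqrt_mul_rpow_half_le_sqrt hc.le (by linarith) (hac _ hy)
      have hpow : 0 < (1 + g x) ^ (k / 2) := by positivity
      rw [(hd x hx0).deriv, add_sub_cancel_right, le_div_iff₀ (by positivity)]
      have h0 : 0 < √(a (g x)) := lt_of_lt_of_le (by positivity) hsq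
      calc _ = (k / 2 + 1) * ((√c * (1 + g x) ^ (k / 2)) / √(a (g x))) := by ring
        _ ≤ (k / 2 + 1) * 1 := by
          gcongr
          exact (div_le_one h0).2 hsq
        _ = _ := mul_one _)
    0 (by simp) t ht ht
  simp only [hg0, add_zero, one_rpow, sub_zero] at key
  linarith

theorem abs_div_sqrt_le_one_add_rpow {a : ℝ → ℝ} {c k p m s : ℝ} (hc : 0 < c)
    (hac : c * (1 + s) ^ k ≤ a s) (hp : 1 < p) (hm : 0 < m) (hs : 0 ≤ s) :
    |(|s| ^ (p - 1) * s - m * s) / √(a s)| ≤ (1 + m) / √c * (1 + s) ^ (p - k / 2) := by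
  have hy : 1 ≤ 1 + s := by linarith
  have hsq : √c * (1 + s) ^ (k / 2) ≤ √(a s) :=
    sqrt_mul_rpow_half_le_sqrt hc.le (by linarith) hac
  have h1 : s ≤ (1 + s) ^ p := by
    have := rpow_le_rpow_of_exponent_le hy hp.le
    rw [rpow_one] at this
    linarith
  have h2 : |s| ^ (p - 1) * s ≤ (1 + s) ^ p := by
    calc |s| ^ (p - 1) * s ≤ (1 + s) ^ (p - 1) * (1 + s) := by
          rw [abs_of_nonneg hs]
          gcongr <;> linarith
      _ = (1 + s) ^ p := by
          rw [← rpow_add_one (by linarith), sub_add_cancel]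
  have hnum : |(|s| ^ (p - 1) * s - m * s)| ≤ (1 + m) * (1 + s) ^ p := by
    have h3 : 0 ≤ |s| ^ (p - 1) * s := by positivity
    have h4 : m * s ≤ m * (1 + s) ^ p := by gcongr
    have h5 : 0 ≤ m * s := by positivity
    rw [abs_le]
    constructor <;> linarith
  have hden : 0 < √c * (1 + s) ^ (k / 2) := by positivity
  rw [abs_div, abs_of_nonneg (Real.sqrt_nonneg _)]
  calc _ ≤ (1 + m) * (1 + s) ^ p / (√c * (1 + s) ^ (k / 2)) := by gcongr
    _ = _ := by
      rw [rpow_sub (by linarith)]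
      ring

theorem tendsto_one_add_mul_rpow_div_rpow_atTop {C β r : ℝ} (hC : 0 ≤ C) (hβ : 0 ≤ β)
    (hr : β < r) : Tendsto (fun t : ℝ => (1 + C * t) ^ β / t ^ r) atTop (𝓝 0) := by
  have hlim : Tendsto (fun t : ℝ => (1 + C) ^ β * t ^ (-(r - β))) atTop (𝓝 0) := by
    simpa using (tendsto_rpow_neg_atTop (sub_pos.2 hr)).const_mul ((1 + C) ^ β)
  refine squeeze_zero' ?_ ?_ hlim
  · filter_upwards [eventually_ge_atTop 1] with t ht
    positivity
  · filter_upwards [eventually_ge_atTop 1] with t ht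
    have ht0 : 0 < t := by linarith
    calc (1 + C * t) ^ β / t ^ r ≤ ((1 + C) * t) ^ β / t ^ r := by
          gcongr
          linarith
      _ = (1 + C) ^ β * t ^ (-(r - β)) := by
          rw [mul_rpow (by linarith) ht0.le, neg_sub, rpow_sub ht0]
          ring

open Filter Real Topology

theorem dual_nonlinearity_growth
    (N : ℕ) (hN : 3 ≤ N)
    (a : ℝ → ℝ) (ν : ℝ) (hν : 0 < ν)
    (ha : ContDiff ℝ 2 a) (hbound : ∀ s, ν ≤ a s)
    (k a₁ : ℝ) (hk : 0 < k) (ha₁ : 0 < a₁)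
    (hlim : Tendsto (fun s : ℝ => a s / s ^ k) atTop (𝓝 a₁))
    (p m : ℝ) (hp1 : 1 < p) (hp2 : p < ((k + 1) * N + 2) / (N - 2)) (hm : 0 < m)
    (g : ℝ → ℝ)
    (hg : ∀ s, HasDerivAt g (1 / Real.sqrt (a (g s))) s) (hg0 : g 0 = 0)
    (h : ℝ → ℝ)
    (hh : ∀ t, h t = (|g t| ^ (p - 1) * g t - m * g t) / Real.sqrt (a (g t))) :
    Tendsto (fun t : ℝ => |h t| / |t|) (𝓝[≠] 0) (𝓝 (m / a 0)) ∧
    Tendsto (fun t : ℝ => |h t| / t ^ (((N : ℝ) + 2) / ((N : ℝ) - 2))) atTop (𝓝 0) := by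
  have hapos : ∀ s, 0 < a s := fun s => hν.trans_le (hbound s)
  constructor
  · have hgc : ContinuousAt g 0 := (hg 0).continuousAt
    have hgt : Tendsto g (𝓝[≠] 0) (𝓝 0) := by
      simpa [hg0] using hgc.tendsto.mono_left nhdsWithin_le_nhds
    have hslope : Tendsto (fun t => g t / t) (𝓝[≠] 0) (𝓝 (1 / √(a 0))) := by
      have h1 := (hg 0).tendsto_slope
      rw [hg0] at h1
      refine h1.congr fun t => ?_
      simp [slope_def_field, hg0]
    have hcont : ContinuousAt (fun s : ℝ => (|s| ^ (p - 1) - m) / √(a s)) 0 := by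
      refine ContinuousAt.div ?_ ha.continuous.sqrt.continuousAt
        (Real.sqrt_pos.2 (hapos 0)).ne'
      exact (continuous_abs.continuousAt.rpow_const (Or.inr (by linarith))).sub
        continuousAt_const
    have hmain := ((hcont.tendsto.comp hgt).mul hslope).abs
    have hval : |(|(0 : ℝ)| ^ (p - 1) - m) / √(a 0) * (1 / √(a 0))| = m / a 0 := by
      rw [abs_zero, zero_rpow (by linarith), zero_sub, div_mul_div_comm,
        Real.mul_self_sqrt (hapos 0).le, mul_one, abs_div, abs_neg, abs_of_pos hm,
        abs_of_pos (hapos 0)]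
    rw [hval] at hmain
    refine hmain.congr fun t => ?_
    rw [hh, ← abs_div, Function.comp_apply]
    congr 1
    ring
  · obtain ⟨c, hc, hac⟩ := exists_pos_mul_one_add_rpow_le hν hbound hk ha₁ hlim
    have hmono : Monotone g := monotone_of_hasDerivAt_nonneg hg fun s => by
      simp only [Pi.zero_apply]
      positivity
    have hpos : ∀ t, 0 ≤ t → 0 ≤ g t := fun t ht => hg0 ▸ hmono ht
    have hN' : (0 : ℝ) < N - 2 := by
      have : (3 : ℝ) ≤ N := by exact_mod_cast hN
      linarith
    set q : ℝ := max 0 (p - k / 2)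
    set C : ℝ := (k / 2 + 1) / √c
    have hC : 0 ≤ C := by positivity
    have hβ : q / (k / 2 + 1) < ((N : ℝ) + 2) / (N - 2) := by
      rw [div_lt_iff₀ (by positivity)]
      refine max_lt (by positivity) ?_
      have : ((N : ℝ) + 2) / (N - 2) * (k / 2 + 1) = ((k + 1) * N + 2) / (N - 2) - k / 2 := by
        field_simp
        ring
      rw [this]
      linarith
    have hzero := (tendsto_one_add_mul_rpow_div_rpow_atTop hC (by positivity) hβ).const_mul
      ((1 + m) / √c)
    rw [mul_zero] at hzero
    refine squeeze_zero' ?_ ?_ hzero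
    · filter_upwards [eventually_ge_atTop 0] with t ht
      positivity
    · filter_upwards [eventually_ge_atTop 0] with t ht
      have hy := hpos t ht
      rw [← mul_div_assoc, hh]
      gcongr
      calc _ ≤ (1 + m) / √c * (1 + g t) ^ (p - k / 2) :=
            abs_div_sqrt_le_one_add_rpow hc (hac _ hy) hp1 hm hy
        _ ≤ (1 + m) / √c * (1 + g t) ^ q := by
            gcongr
            · linarith
            · exact le_max_right _ _
        _ = (1 + m) / √c * ((1 + g t) ^ (k / 2 + 1)) ^ (q / (k / 2 + 1)) := by
            rw [← rpow_mul (by linarith), mul_div_cancel₀ _ (by positivity)]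
        _ ≤ _ := by
            gcongr
            exact one_add_rpow_le_of_hasDerivAt_one_div_sqrt hc hk hac hg hpos hg0 ht
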